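/- Let ★ be a semistar operation on an integral domain D and let F be a nonzero finitely generated fractional ideal such that (F·F^{-1})^{★_f} = D^★. Then F·D_Q is a nonzero principal fractional ideal of D_Q for every quasi-★_f-maximal ideal Q of D. -/

import Mathlib

variable (D : Type*) [CommRing D] [IsDomain D]

/-- A semistar operation on an integral domain `D`. -/
def IsSemistarOp (s : Submodule D (FractionRing D) → Submodule D (FractionRing D)) : Prop :=
  (∀ z : FractionRing D, z ≠ 0 → ∀ E : Submodule D (FractionRing D), E ≠ ⊥ →
      s (Submodule.span D {z} * E) = Submodule.span D {z} * s E) ∧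
  (∀ E F : Submodule D (FractionRing D), E ≠ ⊥ → F ≠ ⊥ → E ≤ F → s E ≤ s F) ∧
  (∀ E : Submodule D (FractionRing D), E ≠ ⊥ → E ≤ s E) ∧
  (∀ E : Submodule D (FractionRing D), E ≠ ⊥ → s (s E) = s E)

/-- The finite-type operation `★_f` associated to `★`. -/
def starf (s : Submodule D (FractionRing D) → Submodule D (FractionRing D))
    (E : Submodule D (FractionRing D)) : Submodule D (FractionRing D) :=
  ⨆ (F : Submodule D (FractionRing D)) (_ : F ≤ E) (_ : F ≠ ⊥) (_ : F.FG), s F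

/-- An ideal `I` of `D` is a quasi-`★_f`-ideal: `I^{★_f} ∩ D = I`. -/
def IsQuasiIdeal (s : Submodule D (FractionRing D) → Submodule D (FractionRing D))
    (I : Ideal D) : Prop :=
  Submodule.comap (Algebra.linearMap D (FractionRing D))
    (starf D s (Submodule.map (Algebra.linearMap D (FractionRing D)) I)) = I

/-- `Q` is a quasi-`★_f`-maximal ideal: maximal among the proper quasi-`★_f`-ideals. -/
def IsQuasiMaximal (s : Submodule D (FractionRing D) → Submodule D (FractionRing D))
    (Q : Ideal D) : Prop :=
  IsQuasiIdeal D s Q ∧ Q ≠ ⊤ ∧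
    ∀ I : Ideal D, IsQuasiIdeal D s I → I ≠ ⊤ → Q ≤ I → I = Q

/-- The localization `D_Q` viewed as a `D`-submodule of the quotient field. -/
def locSubmodule (Q : Ideal D) : Submodule D (FractionRing D) :=
  Submodule.span D {y : FractionRing D | ∃ s ∉ Q, y * algebraMap D (FractionRing D) s = 1}


variable {D} in
lemma starf_mono' (s : Submodule D (FractionRing D) → Submodule D (FractionRing D))
    {E E' : Submodule D (FractionRing D)} (h : E ≤ E') : starf D s E ≤ starf D s E' := by
  unfold starf
  refine iSup_le fun G => iSup_le fun h1 => iSup_le fun h2 => iSup_le fun h3 => ?_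
  exact le_iSup_of_le G (le_iSup_of_le (h1.trans h) (le_iSup_of_le h2 (le_iSup_of_le h3 le_rfl)))

variable {D} in
lemma le_starf_of {s : Submodule D (FractionRing D) → Submodule D (FractionRing D)}
    {E G : Submodule D (FractionRing D)} (h1 : G ≤ E) (h2 : G ≠ ⊥) (h3 : G.FG) :
    s G ≤ starf D s E := by
  unfold starf
  exact le_iSup_of_le G (le_iSup_of_le h1 (le_iSup_of_le h2 (le_iSup_of_le h3 le_rfl)))

variable {D} in
lemma exists_fg_of_mem {s : Submodule D (FractionRing D) → Submodule D (FractionRing D)}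
    (hs : IsSemistarOp D s) {E : Submodule D (FractionRing D)} {z : FractionRing D}
    (hz : z ∈ starf D s E) (hz0 : z ≠ 0) : ∃ G ≤ E, G ≠ ⊥ ∧ G.FG ∧ z ∈ s G := by
  obtain ⟨-, hmono, -, -⟩ := hs
  let T : Submodule D (FractionRing D) :=
    { carrier := {z | z = 0 ∨ ∃ G ≤ E, G ≠ ⊥ ∧ G.FG ∧ z ∈ s G}
      zero_mem' := Or.inl rfl
      add_mem' := by
        rintro a b (rfl | ⟨G, h1, h2, h3, h4⟩) (rfl | ⟨H, k1, k2, k3, k4⟩)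
        · left; simp
        · right; exact ⟨H, k1, k2, k3, by simpa using k4⟩
        · right; exact ⟨G, h1, h2, h3, by simpa using h4⟩
        · right
          have hne : G ⊔ H ≠ ⊥ := fun h => h2 (le_bot_iff.1 (h ▸ le_sup_left))
          exact ⟨G ⊔ H, sup_le h1 k1, hne, h3.sup k3,
            add_mem (hmono _ _ h2 hne le_sup_left h4) (hmono _ _ k2 hne le_sup_right k4)⟩
      smul_mem' := by
        rintro c a (rfl | ⟨G, h1, h2, h3, h4⟩)
        · left; simp
        · right; exact ⟨G, h1, h2, h3, Submodule.smul_mem _ _ h4⟩ }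
  have hT : starf D s E ≤ T := by
    unfold starf
    refine iSup_le fun G => iSup_le fun h1 => iSup_le fun h2 => iSup_le fun h3 => ?_
    intro a ha
    exact Or.inr ⟨G, h1, h2, h3, ha⟩
  rcases hT hz with h | h
  · exact absurd h hz0
  · exact h

variable {D} in
lemma exists_fg_of_le {s : Submodule D (FractionRing D) → Submodule D (FractionRing D)}
    (hs : IsSemistarOp D s) {E G : Submodule D (FractionRing D)}
    (hG : G.FG) (hle : G ≤ starf D s E) :
    G ≠ ⊥ → ∃ H ≤ E, H ≠ ⊥ ∧ H.FG ∧ G ≤ s H := by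
  have hs' := hs
  obtain ⟨-, hmono, -, -⟩ := hs'
  induction G, hG using Submodule.fg_induction with
  | singleton x =>
    intro hne
    have hx : x ≠ 0 := by rintro rfl; simp at hne
    obtain ⟨H, h1, h2, h3, h4⟩ := exists_fg_of_mem hs (hle (Submodule.mem_span_singleton_self x)) hx
    exact ⟨H, h1, h2, h3, by simpa [Submodule.span_le] using h4⟩
  | sup A B hA hB iA iB =>
    intro hne
    by_cases a0 : A = ⊥
    · subst a0; simp only [bot_sup_eq] at *; exact iB hle hne
    by_cases b0 : B = ⊥
    · subst b0; simp only [sup_bot_eq] at *; exact iA hle hne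
    obtain ⟨G, h1, h2, h3, h4⟩ := iA (le_sup_left.trans hle) a0
    obtain ⟨H, k1, k2, k3, k4⟩ := iB (le_sup_right.trans hle) b0
    have hn : G ⊔ H ≠ ⊥ := fun h => h2 (le_bot_iff.1 (h ▸ le_sup_left))
    exact ⟨G ⊔ H, sup_le h1 k1, hn, h3.sup k3,
      sup_le (h4.trans (hmono _ _ h2 hn le_sup_left)) (k4.trans (hmono _ _ k2 hn le_sup_right))⟩

variable {D} in
lemma le_starf {s : Submodule D (FractionRing D) → Submodule D (FractionRing D)}
    (hs : IsSemistarOp D s) (E : Submodule D (FractionRing D)) : E ≤ starf D s E := by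
  intro x hx
  by_cases h0 : x = 0
  · subst h0; exact zero_mem _
  have hn : Submodule.span D {x} ≠ ⊥ := by simpa using h0
  exact le_starf_of (by simpa [Submodule.span_le] using hx) hn (Submodule.fg_span_singleton x)
    (hs.2.2.1 _ hn (Submodule.mem_span_singleton_self x))

variable {D} in
lemma starf_starf {s : Submodule D (FractionRing D) → Submodule D (FractionRing D)}
    (hs : IsSemistarOp D s) (E : Submodule D (FractionRing D)) :
    starf D s (starf D s E) ≤ starf D s E := by
  intro z hz
  by_cases h0 : z = 0
  · subst h0; exact zero_mem _
  obtain ⟨G, h1, h2, h3, h4⟩ := exists_fg_of_mem hs hz h0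
  obtain ⟨H, k1, k2, k3, k4⟩ := exists_fg_of_le hs h3 h1 h2
  have hn : s H ≠ ⊥ := fun h => h2 (le_bot_iff.1 (h ▸ k4))
  have := hs.2.1 _ _ h2 hn k4 h4
  rw [hs.2.2.2 _ k2] at this
  exact le_starf_of k1 k2 k3 this

variable {D} in
lemma quasiMaximal_mul {s : Submodule D (FractionRing D) → Submodule D (FractionRing D)}
    (hs : IsSemistarOp D s) {Q : Ideal D} (hQ : IsQuasiMaximal D s Q) {x y : D}
    (hx : x ∉ Q) (hy : y ∉ Q) : x * y ∉ Q := by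
  intro hxy
  obtain ⟨hq, -, hmax⟩ := hQ
  let φ := Algebra.linearMap D (FractionRing D)
  let E : Submodule D (FractionRing D) := Submodule.map φ (Q ⊔ Ideal.span {x})
  let I : Ideal D := Submodule.comap φ (starf D s E)
  have hle : Q ⊔ Ideal.span {x} ≤ I := fun a ha => le_starf hs E (Submodule.mem_map_of_mem ha)
  have hI : IsQuasiIdeal D s I := by
    apply le_antisymm
    · intro a ha
      exact starf_starf hs E (starf_mono' s (Submodule.map_comap_le φ _) ha)
    · intro a ha
      exact le_starf hs _ (Submodule.mem_map_of_mem ha)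
  have hxI : x ∈ I := hle (le_sup_right (a := Q) (Ideal.mem_span_singleton_self x))
  have htop : I = ⊤ := by
    by_contra hne
    exact hx (hmax I hI hne (le_sup_left.trans hle) ▸ hxI)
  have h1 : (1 : FractionRing D) ∈ starf D s E := by
    have : (1 : D) ∈ I := htop ▸ Submodule.mem_top
    simpa [I, φ] using this
  obtain ⟨G, g1, g2, g3, g4⟩ := exists_fg_of_mem hs h1 one_ne_zero
  have hy0 : y ≠ 0 := by rintro rfl; exact hy (zero_mem _)
  have hy0' : algebraMap D (FractionRing D) y ≠ 0 := by simpa using hy0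
  have hmem : algebraMap D (FractionRing D) y ∈
      s (Submodule.span D {algebraMap D (FractionRing D) y} * G) := by
    rw [hs.1 _ hy0' _ g2]
    simpa using Submodule.mul_mem_mul (Submodule.mem_span_singleton_self
      (R := D) (algebraMap D (FractionRing D) y)) g4
  have hsub : Submodule.span D {algebraMap D (FractionRing D) y} * G ≤ Submodule.map φ Q := by
    rw [Submodule.mul_le]
    intro a ha b hb
    obtain ⟨c, rfl⟩ := Submodule.mem_span_singleton.1 ha
    obtain ⟨d, hd, rfl⟩ := g1 hb
    obtain ⟨q, hq', t, ht, rfl⟩ := Submodule.mem_sup.1 hd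
    obtain ⟨e, rfl⟩ := Ideal.mem_span_singleton.1 ht
    refine ⟨c * y * (q + x * e), ?_, by simp [φ, Algebra.smul_def]⟩
    have : c * y * (q + x * e) = (c * y) * q + (c * e) * (x * y) := by ring
    rw [this]
    exact add_mem (Ideal.mul_mem_left _ _ hq') (Ideal.mul_mem_left _ _ hxy)
  have hne : Submodule.span D {algebraMap D (FractionRing D) y} * G ≠ ⊥ := by
    intro h
    obtain ⟨g, hg, hg0⟩ := Submodule.exists_mem_ne_zero_of_ne_bot g2
    have := Submodule.mul_mem_mul (Submodule.mem_span_singleton_self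
      (R := D) (algebraMap D (FractionRing D) y)) hg
    rw [h, Submodule.mem_bot] at this
    exact (mul_ne_zero hy0' hg0) this
  have := le_starf_of hsub hne ((Submodule.fg_span_singleton _).mul g3) hmem
  apply hy
  rw [← hq]
  exact this

/-- If `F` is a nonzero finitely generated fractional ideal with
`(F·F⁻¹)^{★_f} = D^★`, then `F·D_Q` is a nonzero principal fractional ideal of
`D_Q` for every quasi-`★_f`-maximal ideal `Q` of `D`. -/
theorem locally_principal_of_star_invertible
    (s : Submodule D (FractionRing D) → Submodule D (FractionRing D))
    (hs : IsSemistarOp D s)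
    (F : Submodule D (FractionRing D)) (hF : F ≠ ⊥) (hfg : F.FG)
    (hinv : starf D s (F * (1 / F)) = s 1) :
    ∀ Q : Ideal D, IsQuasiMaximal D s Q →
      ∃ x : FractionRing D, x ≠ 0 ∧
        F * locSubmodule D Q = Submodule.span D {x} * locSubmodule D Q := by
  intro Q hQ
  have hprime : ∀ {x y : D}, x ∉ Q → y ∉ Q → x * y ∉ Q := fun hx hy => quasiMaximal_mul hs hQ hx hy
  have h1Q : (1 : D) ∉ Q := fun h => hQ.2.1 ((Ideal.eq_top_iff_one _).2 h)
  have hLL : locSubmodule D Q * locSubmodule D Q ≤ locSubmodule D Q := by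
    unfold locSubmodule
    rw [Submodule.span_mul_span]
    apply Submodule.span_mono
    rintro _ ⟨a, ⟨u, hu, hau⟩, b, ⟨v, hv, hbv⟩, rfl⟩
    refine ⟨u * v, hprime hu hv, ?_⟩
    simp only [map_mul]
    linear_combination (b * algebraMap D (FractionRing D) v) * hau + hbv
  have hex : ∃ a ∈ F, ∃ b ∈ (1 / F : Submodule D (FractionRing D)), ∃ d : D, d ∉ Q ∧
      algebraMap D (FractionRing D) d = a * b := by
    by_contra hcon
    push Not at hcon
    have hle : F * (1 / F) ≤ Submodule.map (Algebra.linearMap D (FractionRing D)) Q := by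
      rw [Submodule.mul_le]
      intro a ha b hb
      obtain ⟨d, hd⟩ := Submodule.mem_one.1 (Submodule.mem_div_iff_forall_mul_mem.1 hb a ha)
      rw [mul_comm] at hd
      by_cases hdQ : d ∈ Q
      · exact ⟨d, hdQ, hd⟩
      · exact absurd hd (hcon a ha b hb d hdQ)
    have h1 : (1 : FractionRing D) ∈ s 1 := hs.2.2.1 1 one_ne_zero (Submodule.mem_one.2 ⟨1, map_one _⟩)
    rw [← hinv] at h1
    apply h1Q
    rw [← hQ.1]
    simpa using starf_mono' s hle h1
  obtain ⟨a, ha, b, hb, d, hdQ, hd⟩ := hex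
  have hd0 : algebraMap D (FractionRing D) d ≠ 0 := by
    have : d ≠ 0 := by rintro rfl; exact hdQ (zero_mem _)
    simpa using this
  refine ⟨a, ?_, ?_⟩
  · rintro rfl
    exact hd0 (by simpa using hd)
  apply le_antisymm
  · have hF' : F ≤ Submodule.span D {a} * locSubmodule D Q := by
      intro y hy
      obtain ⟨e, he⟩ := Submodule.mem_one.1 (Submodule.mem_div_iff_forall_mul_mem.1 hb y hy)
      have hm : (algebraMap D (FractionRing D) d)⁻¹ ∈ locSubmodule D Q :=
        Submodule.subset_span ⟨d, hdQ, inv_mul_cancel₀ hd0⟩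
      have := Submodule.mul_mem_mul (Submodule.mem_span_singleton_self (R := D) a)
        (Submodule.smul_mem _ e hm)
      convert this using 1
      rw [Algebra.smul_def, he]
      field_simp
      rw [hd]; ring
    calc F * locSubmodule D Q ≤ Submodule.span D {a} * locSubmodule D Q * locSubmodule D Q :=
          mul_le_mul' hF' le_rfl
      _ ≤ _ := by rw [mul_assoc]; exact mul_le_mul' le_rfl hLL
  · exact mul_le_mul' (by simpa [Submodule.span_le] using ha) le_rfl
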